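/- Every weak Hopf algebra A over a field K is a quasi-Frobenius algebra; in particular, A is injective as a left module over itself (the left regular A-module is an injective A-module). -/

import Mathlib

open TensorProduct

noncomputable section

variable (K : Type*) [Field K] (A : Type*) [Ring A] [Algebra K A]

/-- `Π^L(x) = Σ ε(1₍₁₎ x) 1₍₂₎`. -/
def piL (Δ : A →ₗ[K] A ⊗[K] A) (ε : A →ₗ[K] K) : A →ₗ[K] A :=
  (TensorProduct.lid K A).toLinearMap ∘ₗ ε.rTensor A ∘ₗ
    LinearMap.mulLeft K (Δ 1) ∘ₗ (TensorProduct.mk K A A).flip 1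

/-- `Π^R(x) = Σ 1₍₁₎ ε(x 1₍₂₎)`. -/
def piR (Δ : A →ₗ[K] A ⊗[K] A) (ε : A →ₗ[K] K) : A →ₗ[K] A :=
  (TensorProduct.rid K A).toLinearMap ∘ₗ ε.lTensor A ∘ₗ
    LinearMap.mulRight K (Δ 1) ∘ₗ TensorProduct.mk K A A 1

/-- A weak bialgebra structure on the `K`-algebra `A`, with comultiplication `Δ`
and counit `ε`. -/
structure WeakBialgebra (Δ : A →ₗ[K] A ⊗[K] A) (ε : A →ₗ[K] K) : Prop where
  coassoc : ∀ x : A,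
    (TensorProduct.assoc K A A A) (Δ.rTensor A (Δ x)) = Δ.lTensor A (Δ x)
  counit_left : ∀ x : A, (TensorProduct.lid K A) (ε.rTensor A (Δ x)) = x
  counit_right : ∀ x : A, (TensorProduct.rid K A) (ε.lTensor A (Δ x)) = x
  comul_mul : ∀ x y : A, Δ (x * y) = Δ x * Δ y
  weak_counit_a : ∀ x y z : A,
    ε (x * y * z) =
      LinearMap.mul' K K (TensorProduct.map (ε ∘ₗ LinearMap.mulLeft K x)
        (ε ∘ₗ LinearMap.mulRight K z) (Δ y))
  weak_counit_b : ∀ x y z : A,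
    ε (x * y * z) =
      LinearMap.mul' K K (TensorProduct.map (ε ∘ₗ LinearMap.mulRight K z)
        (ε ∘ₗ LinearMap.mulLeft K x) (Δ y))
  weak_comul_unit_a :
    Δ.rTensor A (Δ 1) =
      (Δ 1 ⊗ₜ[K] (1 : A)) * ((TensorProduct.assoc K A A A).symm ((1 : A) ⊗ₜ[K] Δ 1))
  weak_comul_unit_b :
    Δ.rTensor A (Δ 1) =
      ((TensorProduct.assoc K A A A).symm ((1 : A) ⊗ₜ[K] Δ 1)) * (Δ 1 ⊗ₜ[K] (1 : A))

/-- A weak Hopf algebra structure: a weak bialgebra together with an antipode `S`. -/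
structure WeakHopfAlgebra (Δ : A →ₗ[K] A ⊗[K] A) (ε : A →ₗ[K] K) (S : A →ₗ[K] A) : Prop where
  toWeakBialgebra : WeakBialgebra K A Δ ε
  antipode_a : ∀ x : A,
    LinearMap.mul' K A (LinearMap.lTensor A S (Δ x)) = piL K A Δ ε x
  antipode_b : ∀ x : A,
    LinearMap.mul' K A (LinearMap.rTensor A S (Δ x)) = piR K A Δ ε x
  antipode_c : ∀ x : A,
    LinearMap.mul' K A (TensorProduct.map S (LinearMap.mul' K A ∘ₗ LinearMap.lTensor A S)
      (LinearMap.lTensor A Δ (Δ x))) = S x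

section Contract

variable {K A}
variable {V W : Type*} [AddCommGroup V] [Module K V] [AddCommGroup W] [Module K W]

attribute [fun_prop] IsLinearMap

@[fun_prop]
theorem isLinearMap_id : IsLinearMap K (fun x : V => x) := ⟨fun _ _ => rfl, fun _ _ => rfl⟩

@[fun_prop]
theorem isLinearMap_apply (g : V →ₗ[K] W) : IsLinearMap K (fun x => g x) := g.isLinear

@[fun_prop]
theorem IsLinearMap.comp' {U : Type*} [AddCommGroup U] [Module K U] {g : V → W}
    {f : U → V} (hg : IsLinearMap K g) (hf : IsLinearMap K f) : IsLinearMap K (fun x => g (f x)) :=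
  ⟨fun x y => by rw [hf.map_add, hg.map_add], fun c x => by rw [hf.map_smul, hg.map_smul]⟩

@[fun_prop]
theorem IsLinearMap.mul_const {f : V → A} (hf : IsLinearMap K f) (c : A) :
    IsLinearMap K (fun x => f x * c) :=
  ⟨fun x y => by simp [hf.map_add, add_mul], fun r x => by simp [hf.map_smul]⟩

@[fun_prop]
theorem IsLinearMap.const_mul {f : V → A} (hf : IsLinearMap K f) (c : A) :
    IsLinearMap K (fun x => c * f x) :=
  ⟨fun x y => by simp [hf.map_add, mul_add], fun r x => by simp [hf.map_smul]⟩

@[fun_prop]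
theorem IsLinearMap.smul_const {f : V → K} (hf : IsLinearMap K f) (c : W) :
    IsLinearMap K (fun x => f x • c) :=
  ⟨fun x y => by simp [hf.map_add, add_smul], fun r x => by simp [hf.map_smul, mul_smul]⟩

@[fun_prop]
theorem IsLinearMap.const_smul {f : V → W} (hf : IsLinearMap K f) (c : K) :
    IsLinearMap K (fun x => c • f x) :=
  ⟨fun x y => by simp [hf.map_add], fun r x => by rw [hf.map_smul, smul_comm]⟩

theorem exists_bilinear_lift {T : A → A → V} (h₁ : ∀ b, IsLinearMap K (fun a => T a b))
    (h₂ : ∀ a, IsLinearMap K (T a)) :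
    ∃ Φ : A ⊗[K] A →ₗ[K] V, ∀ a b, Φ (a ⊗ₜ b) = T a b :=
  ⟨TensorProduct.lift (LinearMap.mk₂ K T (fun a a' b => (h₁ b).map_add a a')
    (fun c a b => (h₁ b).map_smul c a) (fun a => (h₂ a).map_add) (fun c a => (h₂ a).map_smul c)),
    fun a b => by simp⟩

theorem exists_trilinear_lift {T : A → A → A → V}
    (h₁ : ∀ b c, IsLinearMap K (fun a => T a b c))
    (h₂ : ∀ a c, IsLinearMap K (fun b => T a b c)) (h₃ : ∀ a b, IsLinearMap K (T a b)) :
    ∃ Φ : A ⊗[K] A ⊗[K] A →ₗ[K] V, ∀ a b c, Φ (a ⊗ₜ b ⊗ₜ c) = T a b c := by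
  choose Ψ hΨ using fun c => exists_bilinear_lift (fun b => h₁ b c) (fun a => h₂ a c)
  refine ⟨TensorProduct.lift (LinearMap.mk₂ K (fun t c => Ψ c t) ?_ ?_ ?_ ?_), ?_⟩
  · simp
  · simp
  · intro t c c'
    rw [← LinearMap.add_apply]
    congr 1
    ext a b
    simp [hΨ, (h₃ a b).map_add]
  · intro r t c
    rw [← LinearMap.smul_apply]
    congr 1
    ext a b
    simp [hΨ, (h₃ a b).map_smul]
  · simp [hΨ]

variable [FiniteDimensional K A]

/-- The sum `Σ T(t₍₁₎, t₍₂₎)` for a tensor `t = Σ t₍₁₎ ⊗ t₍₂₎`, computed in a basis. -/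
def contract (t : A ⊗[K] A) (T : A → A → V) : V :=
  ∑ i, T (TensorProduct.rid K A (((Module.finBasis K A).coord i).lTensor A t))
    (Module.finBasis K A i)

theorem contract_tensor (t : A ⊗[K] A) (Φ : A ⊗[K] A →ₗ[K] V) :
    contract t (fun a b => Φ (a ⊗ₜ b)) = Φ t := by
  unfold contract
  rw [← map_sum]
  congr 1
  induction t with
  | zero => simp
  | add x y hx hy => simp [TensorProduct.add_tmul, Finset.sum_add_distrib, hx, hy]
  | tmul x y =>
    conv_rhs => rw [← (Module.finBasis K A).sum_repr y, TensorProduct.tmul_sum]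
    simp [TensorProduct.smul_tmul]

@[fun_prop]
theorem isLinearMap_contract {f : V → A ⊗[K] A} {T : A → A → W} (hf : IsLinearMap K f)
    (h₁ : ∀ b, IsLinearMap K (fun a => T a b)) : IsLinearMap K (fun x => contract (f x) T) :=
  ⟨fun x y => by simp [contract, hf.map_add, (h₁ _).map_add, Finset.sum_add_distrib],
   fun c x => by simp [contract, hf.map_smul, (h₁ _).map_smul, Finset.smul_sum]⟩

@[fun_prop]
theorem isLinearMap_contract_right (t : A ⊗[K] A) {T : V → A → A → W}
    (h : ∀ a b, IsLinearMap K (fun x => T x a b)) : IsLinearMap K (fun x => contract t (T x)) :=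
  ⟨fun x y => by simp [contract, (h _ _).map_add, Finset.sum_add_distrib],
   fun c x => by simp [contract, (h _ _).map_smul, Finset.smul_sum]⟩

theorem map_contract (t : A ⊗[K] A) {T : A → A → V} {f : V → W} (hf : IsLinearMap K f) :
    f (contract t T) = contract t (fun a b => f (T a b)) :=
  map_sum (hf.mk' f) _ _

theorem contract_comm {M : Type*} [AddCommGroup M] (t s : A ⊗[K] A) (T : A → A → A → A → M) :
    contract t (fun a b => contract s (fun c d => T a b c d)) =
      contract s (fun c d => contract t (fun a b => T a b c d)) :=
  Finset.sum_comm

theorem contract_sum {M ι : Type*} [AddCommGroup M] [Fintype ι] (t : A ⊗[K] A)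
    (T : ι → A → A → M) :
    contract t (fun a b => ∑ i, T i a b) = ∑ i, contract t (T i) :=
  Finset.sum_comm

theorem contract_congr {M : Type*} [AddCommGroup M] (t : A ⊗[K] A) {T T' : A → A → M}
    (h : ∀ a b, T a b = T' a b) :
    contract t T = contract t T' :=
  Finset.sum_congr rfl fun _ _ => h _ _

theorem contract_contract_left (Δ : A →ₗ[K] A ⊗[K] A) (t : A ⊗[K] A)
    (Φ : A ⊗[K] A ⊗[K] A →ₗ[K] V) :
    contract t (fun a b => contract (Δ a) (fun c d => Φ (c ⊗ₜ d ⊗ₜ b))) =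
      Φ (Δ.rTensor A t) := by
  rw [← LinearMap.comp_apply, ← contract_tensor t]
  exact contract_congr t fun a b => contract_tensor (Δ a) (Φ ∘ₗ (TensorProduct.mk K _ A).flip b)

theorem contract_contract_right (Δ : A →ₗ[K] A ⊗[K] A) (t : A ⊗[K] A)
    (Φ : A ⊗[K] A ⊗[K] A →ₗ[K] V) :
    contract t (fun a b => contract (Δ b) (fun c d => Φ (a ⊗ₜ c ⊗ₜ d))) =
      Φ ((TensorProduct.assoc K A A A).symm (Δ.lTensor A t)) := by
  have := contract_tensor t
    (Φ ∘ₗ (TensorProduct.assoc K A A A).symm.toLinearMap ∘ₗ Δ.lTensor A)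
  simp only [LinearMap.comp_apply, LinearEquiv.coe_coe] at this
  rw [← this]
  refine contract_congr t fun a b => ?_
  exact contract_tensor (Δ b)
    (Φ ∘ₗ (TensorProduct.assoc K A A A).symm.toLinearMap ∘ₗ TensorProduct.mk K A _ a)

end Contract

namespace WeakBialgebra

variable {K A} {V : Type*} [AddCommGroup V] [Module K V] [FiniteDimensional K A]
variable {Δ : A →ₗ[K] A ⊗[K] A} {ε : A →ₗ[K] K}

theorem contract_coassoc (h : WeakBialgebra K A Δ ε) (x : A) {T : A → A → A → V}
    (h₁ : ∀ b c, IsLinearMap K (fun a => T a b c))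
    (h₂ : ∀ a c, IsLinearMap K (fun b => T a b c)) (h₃ : ∀ a b, IsLinearMap K (T a b)) :
    contract (Δ x) (fun a b => contract (Δ a) (fun c d => T c d b)) =
      contract (Δ x) (fun a b => contract (Δ b) (fun c d => T a c d)) := by
  obtain ⟨Φ, hΦ⟩ := exists_trilinear_lift h₁ h₂ h₃
  simp only [← hΦ]
  rw [contract_contract_left, contract_contract_right, ← h.coassoc, LinearEquiv.symm_apply_apply]

theorem contract_mul (h : WeakBialgebra K A Δ ε) (x y : A) {T : A → A → V}
    (h₁ : ∀ b, IsLinearMap K (fun a => T a b)) (h₂ : ∀ a, IsLinearMap K (T a)) :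
    contract (Δ (x * y)) T =
      contract (Δ x) (fun a b => contract (Δ y) (fun c d => T (a * c) (b * d))) := by
  obtain ⟨Φ, hΦ⟩ := exists_bilinear_lift h₁ h₂
  obtain rfl : T = fun a b => Φ (a ⊗ₜ b) := by ext; simp [hΦ]
  rw [contract_tensor, h.comul_mul,
    show Φ (Δ x * Δ y) = (Φ ∘ₗ LinearMap.mulRight K (Δ y)) (Δ x) from rfl,
    ← contract_tensor (Δ x)]
  refine contract_congr _ fun a b => ?_
  rw [LinearMap.comp_apply, LinearMap.mulRight_apply,
    show Φ (a ⊗ₜ b * Δ y) = (Φ ∘ₗ LinearMap.mulLeft K (a ⊗ₜ b)) (Δ y) from rfl,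
    ← contract_tensor (Δ y)]
  simp

theorem contract_counit_left (h : WeakBialgebra K A Δ ε) (x : A) {f : A → V}
    (hf : IsLinearMap K f) : contract (Δ x) (fun a b => ε a • f b) = f x := by
  conv_rhs => rw [← h.counit_left x]
  have := contract_tensor (Δ x)
    (hf.mk' f ∘ₗ (TensorProduct.lid K A).toLinearMap ∘ₗ ε.rTensor A)
  simpa using this

theorem contract_counit_right (h : WeakBialgebra K A Δ ε) (x : A) {f : A → V}
    (hf : IsLinearMap K f) : contract (Δ x) (fun a b => ε b • f a) = f x := by
  conv_rhs => rw [← h.counit_right x]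
  have := contract_tensor (Δ x)
    (hf.mk' f ∘ₗ (TensorProduct.rid K A).toLinearMap ∘ₗ ε.lTensor A)
  simpa using this

theorem counit_mul_mul (h : WeakBialgebra K A Δ ε) (x y z : A) :
    ε (x * y * z) = contract (Δ y) (fun a b => ε (x * a) * ε (b * z)) := by
  rw [h.weak_counit_a, ← LinearMap.comp_apply, ← contract_tensor (Δ y)]
  simp

theorem counit_mul_mul' (h : WeakBialgebra K A Δ ε) (x y z : A) :
    ε (x * y * z) = contract (Δ y) (fun a b => ε (a * z) * ε (x * b)) := by
  rw [h.weak_counit_b, ← LinearMap.comp_apply, ← contract_tensor (Δ y)]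
  simp

theorem contract_one_mul (h : WeakBialgebra K A Δ ε) {T : A → A → A → V}
    (h₁ : ∀ b c, IsLinearMap K (fun a => T a b c))
    (h₂ : ∀ a c, IsLinearMap K (fun b => T a b c)) (h₃ : ∀ a b, IsLinearMap K (T a b)) :
    contract (Δ 1) (fun a b => contract (Δ 1) (fun c d => T a (b * c) d)) =
      contract (Δ 1) (fun a b => contract (Δ b) (fun c d => T a c d)) := by
  rw [← contract_coassoc h 1 h₁ h₂ h₃]
  obtain ⟨Φ, hΦ⟩ := exists_trilinear_lift h₁ h₂ h₃
  simp only [← hΦ]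
  rw [contract_contract_left, h.weak_comul_unit_a]
  have key := contract_tensor (Δ 1) (Φ ∘ₗ LinearMap.mulRight K
    ((TensorProduct.assoc K A A A).symm (1 ⊗ₜ[K] Δ 1)) ∘ₗ (TensorProduct.mk K _ A).flip 1)
  simp only [LinearMap.comp_apply, LinearMap.flip_apply, TensorProduct.mk_apply,
    LinearMap.mulRight_apply] at key
  rw [← key]
  refine contract_congr _ fun a b => ?_
  have := contract_tensor (Δ 1) (Φ ∘ₗ LinearMap.mulLeft K (a ⊗ₜ[K] b ⊗ₜ[K] (1 : A)) ∘ₗ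
    (TensorProduct.assoc K A A A).symm.toLinearMap ∘ₗ TensorProduct.mk K A _ 1)
  simpa using this

theorem contract_one_mul' (h : WeakBialgebra K A Δ ε) {T : A → A → A → V}
    (h₁ : ∀ b c, IsLinearMap K (fun a => T a b c))
    (h₂ : ∀ a c, IsLinearMap K (fun b => T a b c)) (h₃ : ∀ a b, IsLinearMap K (T a b)) :
    contract (Δ 1) (fun a b => contract (Δ 1) (fun c d => T a (c * b) d)) =
      contract (Δ 1) (fun a b => contract (Δ b) (fun c d => T a c d)) := by
  rw [← contract_coassoc h 1 h₁ h₂ h₃]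
  obtain ⟨Φ, hΦ⟩ := exists_trilinear_lift h₁ h₂ h₃
  simp only [← hΦ]
  rw [contract_contract_left, h.weak_comul_unit_b]
  have key := contract_tensor (Δ 1) (Φ ∘ₗ LinearMap.mulLeft K
    ((TensorProduct.assoc K A A A).symm (1 ⊗ₜ[K] Δ 1)) ∘ₗ (TensorProduct.mk K _ A).flip 1)
  simp only [LinearMap.comp_apply, LinearMap.flip_apply, TensorProduct.mk_apply,
    LinearMap.mulLeft_apply] at key
  rw [← key]
  refine contract_congr _ fun a b => ?_
  have := contract_tensor (Δ 1) (Φ ∘ₗ LinearMap.mulRight K (a ⊗ₜ[K] b ⊗ₜ[K] (1 : A)) ∘ₗ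
    (TensorProduct.assoc K A A A).symm.toLinearMap ∘ₗ TensorProduct.mk K A _ 1)
  simpa using this

theorem piL_eq (Δ : A →ₗ[K] A ⊗[K] A) (ε : A →ₗ[K] K) (x : A) :
    piL K A Δ ε x = contract (Δ 1) (fun a b => ε (a * x) • b) := by
  have := contract_tensor (Δ 1) ((TensorProduct.lid K A).toLinearMap ∘ₗ ε.rTensor A ∘ₗ
    LinearMap.mulRight K (x ⊗ₜ[K] (1 : A)))
  simpa [piL] using this.symm

theorem piR_eq (Δ : A →ₗ[K] A ⊗[K] A) (ε : A →ₗ[K] K) (x : A) :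
    piR K A Δ ε x = contract (Δ 1) (fun a b => ε (x * b) • a) := by
  have := contract_tensor (Δ 1) ((TensorProduct.rid K A).toLinearMap ∘ₗ ε.lTensor A ∘ₗ
    LinearMap.mulLeft K ((1 : A) ⊗ₜ[K] x))
  simpa [piR] using this.symm

theorem contract_piL_right (h : WeakBialgebra K A Δ ε) (a : A) {T : A → A → V}
    (h₁ : ∀ b, IsLinearMap K (fun a => T a b)) (h₂ : ∀ a, IsLinearMap K (T a)) :
    contract (Δ a) (fun p q => T p (piL K A Δ ε q)) = contract (Δ 1) (fun p q => T (p * a) q) := by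
  calc contract (Δ a) (fun p q => T p (piL K A Δ ε q))
      = contract (Δ (1 * a)) (fun p q => contract (Δ 1) (fun u v => ε (u * q) • T p v)) := by
        rw [one_mul]
        refine contract_congr _ fun p q => ?_
        rw [piL_eq, map_contract _ (h₂ p)]
        exact contract_congr _ fun u v => (h₂ p).map_smul _ _
    _ = contract (Δ 1) (fun r s => contract (Δ 1) (fun u v => contract (Δ a) (fun p q =>
          ε (u * s * q) • T (r * p) v))) := by
        rw [h.contract_mul]
        · simp only [mul_assoc]
          exact contract_congr _ fun r s => contract_comm _ _ _
        all_goals fun_prop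
    _ = contract (Δ 1) (fun s v => contract (Δ s) (fun r x => contract (Δ a) (fun p q =>
          ε (x * q) • T (r * p) v))) := by
        rw [h.contract_one_mul' (T := fun r x v => contract (Δ a) (fun p q =>
          ε (x * q) • T (r * p) v)), ← h.contract_coassoc]
        all_goals fun_prop
    _ = _ := by
        refine contract_congr _ fun s v => ?_
        rw [← h.contract_mul (T := fun p q => ε q • T p v), h.contract_counit_right]
        all_goals fun_prop

theorem contract_piR_left (h : WeakBialgebra K A Δ ε) (a : A) {T : A → A → V}
    (h₁ : ∀ b, IsLinearMap K (fun a => T a b)) (h₂ : ∀ a, IsLinearMap K (T a)) :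
    contract (Δ a) (fun p q => T (piR K A Δ ε p) q) = contract (Δ 1) (fun p q => T p (a * q)) := by
  calc contract (Δ a) (fun p q => T (piR K A Δ ε p) q)
      = contract (Δ 1) (fun r s => contract (Δ (a * 1)) (fun p q => ε (p * s) • T r q)) := by
        rw [mul_one, contract_comm]
        refine contract_congr _ fun p q => ?_
        rw [piR_eq, map_contract _ (h₁ q)]
        exact contract_congr _ fun u v => (h₁ q).map_smul _ _
    _ = contract (Δ 1) (fun r s => contract (Δ 1) (fun u v => contract (Δ a) (fun p q =>
          ε (p * (u * s)) • T r (q * v)))) := by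
        refine contract_congr _ fun r s => ?_
        rw [h.contract_mul, contract_comm]
        · simp only [mul_assoc]
        all_goals fun_prop
    _ = contract (Δ 1) (fun r s => contract (Δ s) (fun u v => contract (Δ a) (fun p q =>
          ε (p * u) • T r (q * v)))) := by
        rw [h.contract_one_mul' (T := fun r x v => contract (Δ a) (fun p q =>
          ε (p * x) • T r (q * v)))]
        all_goals fun_prop
    _ = _ := by
        refine contract_congr _ fun r s => ?_
        rw [contract_comm, ← h.contract_mul (T := fun p q => ε p • T r q), h.contract_counit_left]
        all_goals fun_prop

theorem contract_counit_mul_right (h : WeakBialgebra K A Δ ε) (a y : A) {f : A → V}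
    (hf : IsLinearMap K f) :
    contract (Δ a) (fun p q => ε (q * y) • f p) =
      contract (Δ 1) (fun p q => ε (q * y) • f (a * p)) := by
  symm
  calc contract (Δ 1) (fun p q => ε (q * y) • f (a * p))
      = contract (Δ 1) (fun p q => contract (Δ p) (fun r s => contract (Δ a) (fun u v =>
          (ε (v * s) * ε (q * y)) • f (u * r)))) := by
        refine contract_congr _ fun p q => ?_
        rw [← h.contract_counit_right (a * p) hf, h.contract_mul, contract_comm,
          map_contract _ (f := fun x => ε (q * y) • x)]
        · refine contract_congr _ fun r s => ?_
          rw [map_contract _ (f := fun x => ε (q * y) • x)]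
          · simp only [smul_smul, mul_comm (ε (q * y))]
          all_goals fun_prop
        all_goals fun_prop
    _ = contract (Δ 1) (fun r p => contract (Δ a) (fun u v => ε (v * p * y) • f (u * r))) := by
        rw [h.contract_coassoc 1 (T := fun r s q => contract (Δ a) (fun u v =>
          (ε (v * s) * ε (q * y)) • f (u * r)))]
        · refine contract_congr _ fun r p => ?_
          rw [contract_comm]
          refine contract_congr _ fun u v => ?_
          rw [h.counit_mul_mul, map_contract _ (f := fun x => x • f (u * r))]
          fun_prop
        all_goals simp only [mul_smul]; fun_prop
    _ = _ := by
        rw [contract_comm, ← h.contract_mul (T := fun u p => ε (p * y) • f u), mul_one]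
        all_goals fun_prop

theorem contract_counit_mul_left (h : WeakBialgebra K A Δ ε) (a y : A) {f : A → V}
    (hf : IsLinearMap K f) :
    contract (Δ a) (fun p q => ε (y * p) • f q) =
      contract (Δ 1) (fun p q => ε (y * p) • f (q * a)) := by
  symm
  calc contract (Δ 1) (fun p q => ε (y * p) • f (q * a))
      = contract (Δ 1) (fun p q => contract (Δ q) (fun r s => contract (Δ a) (fun u v =>
          (ε (y * p) * ε (r * u)) • f (s * v)))) := by
        refine contract_congr _ fun p q => ?_
        rw [← h.contract_counit_left (q * a) hf, h.contract_mul,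
          map_contract _ (f := fun x => ε (y * p) • x)]
        · refine contract_congr _ fun r s => ?_
          rw [map_contract _ (f := fun x => ε (y * p) • x)]
          · simp only [smul_smul]
          all_goals fun_prop
        all_goals fun_prop
    _ = contract (Δ 1) (fun q s => contract (Δ a) (fun u v => ε (y * q * u) • f (s * v))) := by
        rw [← h.contract_coassoc 1 (T := fun p r s => contract (Δ a) (fun u v =>
          (ε (y * p) * ε (r * u)) • f (s * v)))]
        · refine contract_congr _ fun q s => ?_
          rw [contract_comm]
          refine contract_congr _ fun u v => ?_
          rw [h.counit_mul_mul, map_contract _ (f := fun x => x • f (s * v))]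
          fun_prop
        all_goals simp only [mul_smul]; fun_prop
    _ = _ := by
        simp only [mul_assoc]
        rw [← h.contract_mul 1 a (T := fun u p => ε (y * u) • f p), one_mul]
        all_goals fun_prop

theorem contract_piR_right (h : WeakBialgebra K A Δ ε) (a : A) {T : A → A → V}
    (h₁ : ∀ b, IsLinearMap K (fun a => T a b)) (h₂ : ∀ a, IsLinearMap K (T a)) :
    contract (Δ a) (fun p q => T p (piR K A Δ ε q)) =
      contract (Δ 1) (fun p q => T (a * p) (piR K A Δ ε q)) := by
  have key : ∀ p q, T p (piR K A Δ ε q) = contract (Δ 1) (fun r s => ε (q * s) • T p r) := by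
    intro p q
    rw [piR_eq, map_contract _ (h₂ p)]
    exact contract_congr _ fun u v => (h₂ p).map_smul _ _
  simp only [key]
  rw [contract_comm (Δ a) (Δ 1), contract_comm (Δ 1) (Δ 1)]
  exact contract_congr _ fun r s => h.contract_counit_mul_right a s (h₁ r)

theorem contract_piL_left (h : WeakBialgebra K A Δ ε) (a : A) {T : A → A → V}
    (h₁ : ∀ b, IsLinearMap K (fun a => T a b)) (h₂ : ∀ a, IsLinearMap K (T a)) :
    contract (Δ a) (fun p q => T (piL K A Δ ε p) q) =
      contract (Δ 1) (fun p q => T (piL K A Δ ε p) (q * a)) := by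
  have key : ∀ p q, T (piL K A Δ ε p) q = contract (Δ 1) (fun r s => ε (r * p) • T s q) := by
    intro p q
    rw [piL_eq, map_contract _ (h₁ q)]
    exact contract_congr _ fun u v => (h₁ q).map_smul _ _
  simp only [key]
  rw [contract_comm (Δ a) (Δ 1), contract_comm (Δ 1) (Δ 1)]
  exact contract_congr _ fun r s => h.contract_counit_mul_left a r (h₂ s)

theorem piR_mul_piL (h : WeakBialgebra K A Δ ε) (x y : A) :
    piR K A Δ ε x * piL K A Δ ε y = piL K A Δ ε y * piR K A Δ ε x := by
  have key (f : A → A → A) (hf₁ : ∀ b, IsLinearMap K (fun a => f a b))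
      (hf₂ : ∀ a, IsLinearMap K (f a)) : f (piR K A Δ ε x) (piL K A Δ ε y) =
      contract (Δ 1) (fun a b => contract (Δ 1) (fun u v =>
        ε (a * y) • ε (x * v) • f u b)) := by
    rw [piL_eq, map_contract _ (hf₂ _)]
    refine contract_congr _ fun a b => ?_
    rw [(hf₂ _).map_smul, piR_eq, map_contract _ (hf₁ b),
      map_contract _ (f := fun z => ε (a * y) • z) (by fun_prop)]
    exact contract_congr _ fun u v => congrArg _ ((hf₁ b).map_smul _ _)
  rw [key (fun a b => a * b) (by fun_prop) (by fun_prop),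
    key (fun a b => b * a) (by fun_prop) (by fun_prop),
    h.contract_one_mul (T := fun a m v => ε (a * y) • ε (x * v) • (m : A))
      (by fun_prop) (by fun_prop) (by fun_prop),
    h.contract_one_mul' (T := fun a m v => ε (a * y) • ε (x * v) • (m : A))
      (by fun_prop) (by fun_prop) (by fun_prop)]

theorem counit_mul_piL (h : WeakBialgebra K A Δ ε) (x y : A) :
    ε (x * piL K A Δ ε y) = ε (x * y) := by
  conv_rhs => rw [← mul_one x, h.counit_mul_mul']
  rw [piL_eq, map_contract _ (f := fun z => ε (x * z)) (by fun_prop)]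
  simp

theorem counit_piR_mul (h : WeakBialgebra K A Δ ε) (x y : A) :
    ε (piR K A Δ ε x * y) = ε (x * y) := by
  conv_rhs => rw [← mul_one x, h.counit_mul_mul']
  rw [piR_eq, map_contract _ (f := fun z => ε (z * y)) (by fun_prop)]
  simp [mul_comm]

theorem piL_mul_piL (h : WeakBialgebra K A Δ ε) (x y : A) :
    piL K A Δ ε (x * piL K A Δ ε y) = piL K A Δ ε (x * y) := by
  simp only [piL_eq _ _ (x * _), ← mul_assoc, h.counit_mul_piL]

theorem piR_piR_mul (h : WeakBialgebra K A Δ ε) (x y : A) :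
    piR K A Δ ε (piR K A Δ ε x * y) = piR K A Δ ε (x * y) := by
  simp only [piR_eq _ _ (_ * y), mul_assoc, h.counit_piR_mul]

theorem contract_comul_piL (h : WeakBialgebra K A Δ ε) (y : A) {T : A → A → V}
    (h₁ : ∀ b, IsLinearMap K (fun a => T a b)) (h₂ : ∀ a, IsLinearMap K (T a)) :
    contract (Δ (piL K A Δ ε y)) T = contract (Δ 1) (fun p q => T (p * piL K A Δ ε y) q) := by
  rw [piL_eq, map_contract _ (f := fun x => contract (Δ x) T) (by fun_prop)]
  calc contract (Δ 1) (fun a b => contract (Δ (ε (a * y) • b)) T)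
      = contract (Δ 1) (fun a b => contract (Δ b) (fun p q => ε (a * y) • T p q)) := by
        refine contract_congr _ fun a b => ?_
        rw [IsLinearMap.map_smul (f := fun x => contract (Δ x) T) (by fun_prop),
          map_contract _ (f := fun x => ε (a * y) • x) (by fun_prop)]
    _ = contract (Δ 1) (fun a b => contract (Δ 1) (fun p q => ε (a * y) • T (p * b) q)) := by
        rw [h.contract_one_mul' (T := fun a p q => ε (a * y) • T p q)]
        all_goals fun_prop
    _ = _ := by
        rw [contract_comm]
        refine contract_congr _ fun p q => ?_
        rw [map_contract _ (f := fun z => T (p * z) q) (by fun_prop)]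
        refine contract_congr _ fun a b => ?_
        rw [IsLinearMap.map_smul (f := fun z => T (p * z) q) (by fun_prop)]

theorem contract_comul_piR (h : WeakBialgebra K A Δ ε) (y : A) {T : A → A → V}
    (h₁ : ∀ b, IsLinearMap K (fun a => T a b)) (h₂ : ∀ a, IsLinearMap K (T a)) :
    contract (Δ (piR K A Δ ε y)) T = contract (Δ 1) (fun p q => T p (piR K A Δ ε y * q)) := by
  rw [piR_eq, map_contract _ (f := fun x => contract (Δ x) T) (by fun_prop)]
  calc contract (Δ 1) (fun a b => contract (Δ (ε (y * b) • a)) T)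
      = contract (Δ 1) (fun a b => contract (Δ a) (fun p q => ε (y * b) • T p q)) := by
        refine contract_congr _ fun a b => ?_
        rw [IsLinearMap.map_smul (f := fun x => contract (Δ x) T) (by fun_prop),
          map_contract _ (f := fun x => ε (y * b) • x) (by fun_prop)]
    _ = contract (Δ 1) (fun a b => contract (Δ 1) (fun p q => ε (y * q) • T a (p * b))) := by
        rw [h.contract_coassoc 1 (T := fun a p q => ε (y * q) • T a p),
          h.contract_one_mul' (T := fun a p q => ε (y * q) • T a p)]
        all_goals fun_prop
    _ = _ := by
        refine contract_congr _ fun p q => ?_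
        rw [map_contract _ (f := fun z => T p (z * q)) (by fun_prop)]
        refine contract_congr _ fun a b => ?_
        rw [IsLinearMap.map_smul (f := fun z => T p (z * q)) (by fun_prop)]

end WeakBialgebra

namespace WeakHopfAlgebra

variable {K A} {V : Type*} [AddCommGroup V] [Module K V] [FiniteDimensional K A]
variable {Δ : A →ₗ[K] A ⊗[K] A} {ε : A →ₗ[K] K} {S : A →ₗ[K] A}

theorem contract_mul_antipode (hA : WeakHopfAlgebra K A Δ ε S) (x : A) :
    contract (Δ x) (fun a b => a * S b) = piL K A Δ ε x := by
  rw [← hA.antipode_a]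
  have := contract_tensor (Δ x) (LinearMap.mul' K A ∘ₗ S.lTensor A)
  simpa using this

theorem contract_antipode_mul (hA : WeakHopfAlgebra K A Δ ε S) (x : A) :
    contract (Δ x) (fun a b => S a * b) = piR K A Δ ε x := by
  rw [← hA.antipode_b]
  have := contract_tensor (Δ x) (LinearMap.mul' K A ∘ₗ S.rTensor A)
  simpa using this

theorem contract_antipode_mul_piL (hA : WeakHopfAlgebra K A Δ ε S) (x : A) :
    contract (Δ x) (fun a b => S a * piL K A Δ ε b) = S x := by
  rw [← hA.antipode_c]
  have := contract_tensor (Δ x) (LinearMap.mul' K A ∘ₗ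
    TensorProduct.map S (LinearMap.mul' K A ∘ₗ S.lTensor A) ∘ₗ Δ.lTensor A)
  simp only [LinearMap.comp_apply] at this
  rw [← this]
  refine contract_congr _ fun a b => ?_
  simp [← hA.antipode_a]

theorem contract_piR_mul_antipode (hA : WeakHopfAlgebra K A Δ ε S) (x : A) :
    contract (Δ x) (fun a b => piR K A Δ ε a * S b) = S x := by
  rw [← hA.contract_antipode_mul_piL]
  calc _ = contract (Δ x) (fun a b => contract (Δ a) (fun c d => S c * d * S b)) := by
        refine contract_congr _ fun a b => ?_
        rw [← hA.contract_antipode_mul, map_contract _ (f := fun z => z * S b) (by fun_prop)]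
    _ = _ := by
        rw [hA.toWeakBialgebra.contract_coassoc x (T := fun c d b => S c * d * S b)]
        · refine contract_congr _ fun a b => ?_
          rw [← hA.contract_mul_antipode, map_contract _ (f := fun z => S a * z) (by fun_prop)]
          simp only [mul_assoc]
        all_goals fun_prop

theorem antipode_eq_contract_left (hA : WeakHopfAlgebra K A Δ ε S) (x : A) :
    contract (Δ 1) (fun p q => p * S (x * q)) = S x := by
  rw [← hA.contract_piR_mul_antipode x,
    hA.toWeakBialgebra.contract_piR_left x (T := fun a b => a * S b)]
  all_goals fun_prop

theorem antipode_eq_contract_right (hA : WeakHopfAlgebra K A Δ ε S) (x : A) :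
    contract (Δ 1) (fun p q => S (p * x) * q) = S x := by
  rw [← hA.contract_antipode_mul_piL x,
    hA.toWeakBialgebra.contract_piL_right x (T := fun a b => S a * b)]
  all_goals fun_prop

theorem contract_piR_right (hA : WeakHopfAlgebra K A Δ ε S) (a : A) {T : A → A → V}
    (h₁ : ∀ b, IsLinearMap K (fun a => T a b)) (h₂ : ∀ a, IsLinearMap K (T a)) :
    contract (Δ a) (fun p q => T p (piR K A Δ ε q)) =
      contract (Δ 1) (fun p q => T (a * p) (S q)) := by
  rw [hA.toWeakBialgebra.contract_piR_right a h₁ h₂]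
  calc _ = contract (Δ 1) (fun p q => contract (Δ q) (fun r s => T (a * p) (S r * s))) := by
        refine contract_congr _ fun p q => ?_
        rw [← hA.contract_antipode_mul, map_contract _ (h₂ _)]
    _ = _ := by
        rw [← hA.toWeakBialgebra.contract_one_mul' (T := fun p r s => T (a * p) (S r * s))]
        · refine contract_congr _ fun p q => ?_
          rw [← map_contract _ (h₂ (a * p)), hA.antipode_eq_contract_right]
        all_goals fun_prop

theorem contract_piL_left (hA : WeakHopfAlgebra K A Δ ε S) (a : A) {T : A → A → V}
    (h₁ : ∀ b, IsLinearMap K (fun a => T a b)) (h₂ : ∀ a, IsLinearMap K (T a)) :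
    contract (Δ a) (fun p q => T (piL K A Δ ε p) q) =
      contract (Δ 1) (fun p q => T (S p) (q * a)) := by
  rw [hA.toWeakBialgebra.contract_piL_left a h₁ h₂]
  calc _ = contract (Δ 1) (fun p q => contract (Δ p) (fun r s => T (r * S s) (q * a))) := by
        refine contract_congr _ fun p q => ?_
        rw [← hA.contract_mul_antipode, map_contract _ (h₁ _)]
    _ = _ := by
        rw [hA.toWeakBialgebra.contract_coassoc 1 (T := fun r s q => T (r * S s) (q * a)),
          ← hA.toWeakBialgebra.contract_one_mul' (T := fun r s q => T (r * S s) (q * a)),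
          contract_comm]
        · refine contract_congr _ fun p q => ?_
          rw [← map_contract _ (h₁ (q * a)), hA.antipode_eq_contract_left]
        all_goals fun_prop

theorem piL_mul (hA : WeakHopfAlgebra K A Δ ε S) (x y : A) :
    piL K A Δ ε (x * y) = contract (Δ x) (fun p q => p * piL K A Δ ε y * S q) := by
  have h := hA.toWeakBialgebra
  rw [← h.piL_mul_piL, ← hA.contract_mul_antipode, h.contract_mul]
  · calc _ = contract (Δ x) (fun p q => contract (Δ 1) (fun r s =>
          p * (r * piL K A Δ ε y) * S (q * s))) := by
          refine contract_congr _ fun p q => ?_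
          rw [h.contract_comul_piL y (T := fun c d => p * c * S (q * d))]
          all_goals fun_prop
      _ = contract (Δ (x * 1)) (fun p q => p * piL K A Δ ε y * S q) := by
          rw [h.contract_mul]
          · simp only [mul_assoc]
          all_goals fun_prop
      _ = _ := by rw [mul_one]
  all_goals fun_prop

theorem piR_mul (hA : WeakHopfAlgebra K A Δ ε S) (x y : A) :
    piR K A Δ ε (x * y) = contract (Δ y) (fun p q => S p * piR K A Δ ε x * q) := by
  have h := hA.toWeakBialgebra
  rw [← h.piR_piR_mul, ← hA.contract_antipode_mul, h.contract_mul]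
  · calc _ = contract (Δ 1) (fun r s => contract (Δ y) (fun p q =>
          S (r * p) * (piR K A Δ ε x * s * q))) := by
          rw [h.contract_comul_piR x (T := fun a b => contract (Δ y) (fun c d =>
            S (a * c) * (b * d)))]
          all_goals fun_prop
      _ = contract (Δ (1 * y)) (fun p q => S p * piR K A Δ ε x * q) := by
          rw [h.contract_mul]
          · simp only [mul_assoc]
          all_goals fun_prop
      _ = _ := by rw [one_mul]
  all_goals fun_prop

theorem antipode_mul (hA : WeakHopfAlgebra K A Δ ε S) (x y : A) : S (x * y) = S y * S x := by
  have h := hA.toWeakBialgebra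
  calc S (x * y)
      = contract (Δ x) (fun p q => contract (Δ y) (fun r s =>
          S (p * r) * piL K A Δ ε (q * s))) := by
        rw [← hA.contract_antipode_mul_piL, h.contract_mul]
        all_goals fun_prop
    _ = contract (Δ x) (fun p q => contract (Δ q) (fun u v =>
          contract (Δ y) (fun r s => contract (Δ s) (fun m n =>
            S (p * r) * (u * m) * (S n * S v))))) := by
        refine contract_congr _ fun p q => ?_
        rw [contract_comm]
        refine contract_congr _ fun r s => ?_
        rw [hA.piL_mul, map_contract _ (f := fun z => S (p * r) * z) (by fun_prop)]
        refine contract_congr _ fun u v => ?_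
        rw [← hA.contract_mul_antipode,
          map_contract _ (f := fun z => S (p * r) * (u * z * S v)) (by fun_prop)]
        simp only [mul_assoc]
    _ = contract (Δ x) (fun x' v => contract (Δ y) (fun y' n =>
          piR K A Δ ε (x' * y') * (S n * S v))) := by
        rw [← h.contract_coassoc x (T := fun p u v =>
          contract (Δ y) (fun r s => contract (Δ s) (fun m n =>
            S (p * r) * (u * m) * (S n * S v))))]
        · refine contract_congr _ fun x' v => ?_
          calc _ = contract (Δ x') (fun p u => contract (Δ y) (fun y' n =>
                  contract (Δ y') (fun r m => S (p * r) * (u * m) * (S n * S v)))) := by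
                refine contract_congr _ fun p u => ?_
                rw [h.contract_coassoc y (T := fun r m n => S (p * r) * (u * m) * (S n * S v))]
                all_goals fun_prop
            _ = _ := by
                rw [contract_comm]
                refine contract_congr _ fun y' n => ?_
                rw [← hA.contract_antipode_mul, h.contract_mul,
                  map_contract _ (f := fun z => z * (S n * S v)) (by fun_prop)]
                · refine contract_congr _ fun p u => ?_
                  rw [map_contract _ (f := fun z => z * (S n * S v)) (by fun_prop)]
                all_goals fun_prop
        all_goals fun_prop
    _ = contract (Δ x) (fun x' v => contract (Δ y) (fun r s =>
          S r * piL K A Δ ε s * (piR K A Δ ε x' * S v))) := by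
        refine contract_congr _ fun x' v => ?_
        calc _ = contract (Δ y) (fun y' n => contract (Δ y') (fun r m =>
                S r * piR K A Δ ε x' * m * (S n * S v))) := by
              refine contract_congr _ fun y' n => ?_
              rw [hA.piR_mul, map_contract _ (f := fun z => z * (S n * S v)) (by fun_prop)]
          _ = _ := by
              rw [h.contract_coassoc y (T := fun r m n =>
                S r * piR K A Δ ε x' * m * (S n * S v))]
              · refine contract_congr _ fun r s => ?_
                rw [mul_assoc (S r), ← mul_assoc (piL K A Δ ε s), ← h.piR_mul_piL,
                  ← hA.contract_mul_antipode s,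
                  map_contract _ (f := fun z => S r * (piR K A Δ ε x' * z * S v)) (by fun_prop)]
                simp only [mul_assoc]
              all_goals fun_prop
    _ = S y * S x := by
        rw [← hA.contract_antipode_mul_piL y, ← hA.contract_piR_mul_antipode x,
          map_contract _ (f := fun z => contract (Δ y) (fun a b => S a * piL K A Δ ε b) * z)
            (by fun_prop)]
        refine contract_congr _ fun x' v => ?_
        rw [map_contract _ (f := fun z => z * (piR K A Δ ε x' * S v)) (by fun_prop)]

theorem piL_one (hA : WeakHopfAlgebra K A Δ ε S) : piL K A Δ ε 1 = 1 := by
  simpa [WeakBialgebra.piL_eq] using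
    hA.toWeakBialgebra.contract_counit_left 1 (f := fun x : A => x) (by fun_prop)

theorem piR_one (hA : WeakHopfAlgebra K A Δ ε S) : piR K A Δ ε 1 = 1 := by
  simpa [WeakBialgebra.piR_eq] using
    hA.toWeakBialgebra.contract_counit_right 1 (f := fun x : A => x) (by fun_prop)

/-- A map commuting with left multiplication by the image of the antipode is `A`-linear. -/
theorem map_mul_of_map_antipode_mul (hA : WeakHopfAlgebra K A Δ ε S) {f : A → A}
    (hf : IsLinearMap K f) (hS : ∀ a y, f (S a * y) = S a * f y) (a y : A) :
    f (a * y) = a * f y := by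
  have h := hA.toWeakBialgebra
  calc f (a * y)
      = contract (Δ 1) (fun p q => S p * f (q * a * y)) := by
        simp only [← hS, mul_assoc]
        rw [← map_contract _ (f := fun z => f z) (by fun_prop)]
        simp only [← mul_assoc]
        rw [← map_contract _ (f := fun z => z * a * y) (by fun_prop), hA.contract_antipode_mul,
          hA.piR_one, one_mul]
    _ = contract (Δ a) (fun p q => contract (Δ p) (fun c d => c * S d * f (q * y))) := by
        rw [← hA.contract_piL_left a (T := fun p q => p * f (q * y))]
        · refine contract_congr _ fun p q => ?_
          rw [← hA.contract_mul_antipode,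
            map_contract _ (f := fun z => z * f (q * y)) (by fun_prop)]
        all_goals fun_prop
    _ = contract (Δ a) (fun p q => p * f (piR K A Δ ε q * y)) := by
        rw [h.contract_coassoc a (T := fun c d q => c * S d * f (q * y))]
        · refine contract_congr _ fun p q => ?_
          rw [← hA.contract_antipode_mul,
            map_contract _ (f := fun z => p * f (z * y)) (by fun_prop)]
          simp only [mul_assoc, hS]
        all_goals fun_prop
    _ = a * f y := by
        rw [hA.contract_piR_right a (T := fun p q => p * f (q * y))]
        · calc _ = contract (Δ 1) (fun p q => a * (p * S q * f y)) := by
                simp only [hS, mul_assoc]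
            _ = _ := ?_
          rw [← map_contract _ (f := fun z => a * (z * f y)) (by fun_prop),
            hA.contract_mul_antipode, hA.piL_one, one_mul]
        all_goals fun_prop

theorem contract_antipode_mul_contract (hA : WeakHopfAlgebra K A Δ ε S) (c e : A)
    (k : A →ₗ[K] K) :
    contract (Δ c) (fun b d => S b * contract (Δ (d * e)) (fun p u => k u • p)) =
      contract (Δ e) (fun p u => k (c * u) • p) := by
  have h := hA.toWeakBialgebra
  calc contract (Δ c) (fun b d => S b * contract (Δ (d * e)) (fun p u => k u • p))
      = contract (Δ c) (fun b d => contract (Δ d) (fun d₁ d₂ => contract (Δ e) (fun p u =>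
          k (d₂ * u) • (S b * d₁ * p)))) := by
        refine contract_congr _ fun b d => ?_
        rw [h.contract_mul, map_contract _ (f := fun z => S b * z) (by fun_prop)]
        · refine contract_congr _ fun d₁ d₂ => ?_
          rw [map_contract _ (f := fun z => S b * z) (by fun_prop)]
          simp only [mul_smul_comm, mul_assoc]
        all_goals fun_prop
    _ = contract (Δ c) (fun b d => contract (Δ e) (fun p u =>
          k (d * u) • (piR K A Δ ε b * p))) := by
        rw [← h.contract_coassoc c (T := fun b d₁ d₂ => contract (Δ e) (fun p u =>
          k (d₂ * u) • (S b * d₁ * p)))]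
        · refine contract_congr _ fun b d => ?_
          rw [contract_comm]
          refine contract_congr _ fun p u => ?_
          rw [← hA.contract_antipode_mul,
            map_contract _ (f := fun z => k (d * u) • (z * p)) (by fun_prop)]
        all_goals fun_prop
    _ = contract (Δ (1 * e)) (fun p u => k (c * u) • p) := by
        rw [h.contract_piR_left c (T := fun b d => contract (Δ e) (fun p u =>
          k (d * u) • (b * p))), h.contract_mul]
        · simp only [mul_assoc]
        all_goals fun_prop
    _ = _ := by rw [one_mul]

theorem contract_antipode_antipode (hA : WeakHopfAlgebra K A Δ ε S) (g : A →ₗ[K] A)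
    (φ : A →ₗ[K] K) (a u y : A) :
    contract (Δ a) (fun c f => contract (Δ (c * u)) (fun q r =>
      φ (S f * (S (S r) * g (S q * y))))) =
    contract (Δ u) (fun q r => φ (S (S r) * g (S q * (S a * y)))) := by
  have h := hA.toWeakBialgebra
  calc _ = contract (Δ a) (fun c f => contract (Δ c) (fun m n => contract (Δ u) (fun q r =>
          φ (S (S r * (S n * f)) * g (S (m * q) * y))))) := by
        refine contract_congr _ fun c f => ?_
        rw [h.contract_mul]
        · simp only [hA.antipode_mul, mul_assoc]
        all_goals fun_prop
    _ = contract (Δ a) (fun m c => contract (Δ u) (fun q r =>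
          φ (S (S r * piR K A Δ ε c) * g (S (m * q) * y)))) := by
        rw [h.contract_coassoc a (T := fun m n f => contract (Δ u) (fun q r =>
          φ (S (S r * (S n * f)) * g (S (m * q) * y))))]
        · refine contract_congr _ fun m c => ?_
          rw [contract_comm]
          refine contract_congr _ fun q r => ?_
          rw [← hA.contract_antipode_mul,
            map_contract _ (f := fun z => φ (S (S r * z) * g (S (m * q) * y))) (by fun_prop)]
        all_goals fun_prop
    _ = contract (Δ (1 * u)) (fun q r => φ (S (S r) * g (S (a * q) * y))) := by
        rw [hA.contract_piR_right a (T := fun m c => contract (Δ u) (fun q r =>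
          φ (S (S r * c) * g (S (m * q) * y)))), h.contract_mul]
        · simp only [hA.antipode_mul, mul_assoc]
        all_goals fun_prop
    _ = _ := by simp only [one_mul, hA.antipode_mul, mul_assoc]

theorem sum_dual_basis_mul (a : A) {G : A → (A →ₗ[K] K) → V}
    (h₁ : ∀ φ, IsLinearMap K (fun e => G e φ)) (h₂ : ∀ e, IsLinearMap K (G e)) :
    ∑ i, G (a * Module.finBasis K A i) ((Module.finBasis K A).coord i) =
      ∑ i, G (Module.finBasis K A i) ((Module.finBasis K A).coord i ∘ₗ LinearMap.mulLeft K a) := by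
  set b := Module.finBasis K A
  have e₁ (i) : G (a * b i) (b.coord i) = ∑ j, b.repr (a * b i) j • G (b j) (b.coord i) := by
    conv_lhs => rw [← b.sum_repr (a * b i)]
    have := map_sum ((h₁ (b.coord i)).mk' _) (fun j => b.repr (a * b i) j • b j) Finset.univ
    simpa [(h₁ _).map_smul] using this
  have e₂ (j) : G (b j) (b.coord j ∘ₗ LinearMap.mulLeft K a) =
      ∑ i, b.repr (a * b i) j • G (b j) (b.coord i) := by
    have : b.coord j ∘ₗ LinearMap.mulLeft K a = ∑ i, b.repr (a * b i) j • b.coord i := by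
      refine b.ext fun i => ?_
      simp [Finsupp.single_apply]
    rw [this]
    have := map_sum ((h₂ (b j)).mk' _) (fun i => b.repr (a * b i) j • b.coord i) Finset.univ
    exact this.trans (Finset.sum_congr rfl fun i _ => (h₂ _).map_smul _ _)
  simp only [e₁, e₂]
  exact Finset.sum_comm

/-- The average of a `K`-linear endomorphism `g` of `A`: it commutes with left multiplication by
the image of the antipode. -/
def average (Δ : A →ₗ[K] A ⊗[K] A) (S g : A →ₗ[K] A) (y : A) : A :=
  ∑ i, contract (Δ (Module.finBasis K A i)) (fun p u =>
    contract (Δ u) (fun q r =>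
      (Module.finBasis K A).coord i (S (S r) * g (S q * y))) • p)

@[fun_prop]
theorem isLinearMap_sum {ι W : Type*} [Fintype ι] [AddCommGroup W] [Module K W]
    {f : ι → V → W} (hf : ∀ i, IsLinearMap K (f i)) : IsLinearMap K (fun x => ∑ i, f i x) :=
  ⟨fun x y => by simp [(hf _).map_add, Finset.sum_add_distrib],
   fun c x => by simp [(hf _).map_smul, Finset.smul_sum]⟩

theorem isLinearMap_average (Δ : A →ₗ[K] A ⊗[K] A) (S g : A →ₗ[K] A) :
    IsLinearMap K (average Δ S g) := by
  change IsLinearMap K (fun y => average Δ S g y)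
  unfold average
  fun_prop

theorem sum_coord_mul (Δ : A →ₗ[K] A ⊗[K] A) (W : A → A → A)
    (h₁ : ∀ b, IsLinearMap K (fun a => W a b)) (h₂ : ∀ a, IsLinearMap K (W a)) (d : A) :
    ∑ i, contract (Δ (Module.finBasis K A i)) (fun p u =>
      contract (Δ u) (fun q r => (Module.finBasis K A).coord i (d * W q r)) • p) =
    ∑ i, contract (Δ (d * Module.finBasis K A i)) (fun p u =>
      contract (Δ u) (fun q r => (Module.finBasis K A).coord i (W q r)) • p) := by
  have dual (w : A) : IsLinearMap K (fun φ : A →ₗ[K] K => φ w) := ⟨by simp, by simp⟩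
  exact (sum_dual_basis_mul d (G := fun e φ => contract (Δ e) (fun p u =>
    contract (Δ u) (fun q r => φ (W q r)) • p)) (by fun_prop)
    (fun e => isLinearMap_contract_right _ fun p u => IsLinearMap.smul_const
      (isLinearMap_contract_right _ fun q r => dual _) p)).symm

theorem average_antipode_mul (hA : WeakHopfAlgebra K A Δ ε S) (g : A →ₗ[K] A) (a y : A) :
    average Δ S g (S a * y) = S a * average Δ S g y := by
  have h := hA.toWeakBialgebra
  let b := Module.finBasis K A
  let H (d : A) : A := ∑ i, contract (Δ (b i)) (fun p u =>
    contract (Δ u) (fun q r => b.coord i (d * (S (S r) * g (S q * y)))) • p)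
  trans contract (Δ a) (fun c d => S c * H (piL K A Δ ε d))
  · symm
    calc contract (Δ a) (fun c d => S c * H (piL K A Δ ε d))
        = contract (Δ a) (fun c d => contract (Δ d) (fun m f => S c * H (m * S f))) := by
          refine contract_congr _ fun c d => ?_
          rw [← hA.contract_mul_antipode, map_contract _ (f := fun z => S c * H z)]
          fun_prop
      _ = contract (Δ a) (fun d f => contract (Δ d) (fun c m => S c * H (m * S f))) := by
          rw [h.contract_coassoc a (T := fun c m f => S c * H (m * S f))]
          all_goals fun_prop
      _ = contract (Δ a) (fun d f => ∑ i, contract (Δ (b i)) (fun p u =>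
            contract (Δ (d * u)) (fun q r =>
              b.coord i (S f * (S (S r) * g (S q * y)))) • p)) := by
          refine contract_congr _ fun d f => ?_
          have e (m : A) : H (m * S f) = ∑ i, contract (Δ (m * b i)) (fun p u =>
              contract (Δ u) (fun q r => b.coord i (S f * (S (S r) * g (S q * y)))) • p) := by
            simp only [H, mul_assoc m]
            exact sum_coord_mul Δ (fun q r => S f * (S (S r) * g (S q * y)))
              (by fun_prop) (by fun_prop) m
          simp only [e, Finset.mul_sum]
          rw [contract_sum]
          refine Finset.sum_congr rfl fun i _ => ?_
          have hk : IsLinearMap K (fun u => contract (Δ u) (fun q r =>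
            b.coord i (S f * (S (S r) * g (S q * y))))) := by fun_prop
          exact hA.contract_antipode_mul_contract d (b i) (hk.mk' _)
      _ = average Δ S g (S a * y) := by
          rw [contract_sum]
          refine Finset.sum_congr rfl fun i _ => ?_
          rw [contract_comm]
          refine contract_congr _ fun p u => ?_
          rw [← hA.contract_antipode_antipode, map_contract _ (f := fun z => z • p) (by fun_prop)]
  · calc contract (Δ a) (fun c d => S c * H (piL K A Δ ε d))
        = contract (Δ 1) (fun c d => S a * (S c * H d)) := by
          rw [h.contract_piL_right a (T := fun c d => S c * H d)]
          · simp only [hA.antipode_mul, mul_assoc]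
          all_goals fun_prop
      _ = S a * contract (Δ 1) (fun c d => S c * H d) := by
          rw [map_contract _ (f := fun z => S a * z) (by fun_prop)]
      _ = _ := by
          congr 1
          have e (m : A) : H m = ∑ i, contract (Δ (m * b i)) (fun p u =>
              contract (Δ u) (fun q r => b.coord i (S (S r) * g (S q * y))) • p) :=
            sum_coord_mul Δ (fun q r => S (S r) * g (S q * y)) (by fun_prop) (by fun_prop) m
          simp only [e, Finset.mul_sum]
          rw [contract_sum]
          refine Finset.sum_congr rfl fun i _ => ?_
          have hk : IsLinearMap K (fun u => contract (Δ u) (fun q r =>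
            b.coord i (S (S r) * g (S q * y)))) := by fun_prop
          have := hA.contract_antipode_mul_contract 1 (b i) (hk.mk' _)
          simp only [one_mul, IsLinearMap.mk'_apply] at this
          exact this

theorem average_eq (hA : WeakHopfAlgebra K A Δ ε S) (g : A →ₗ[K] A) (y : A)
    (hg : ∀ a, g (S a * y) = S a * g y) : average Δ S g y = g y := by
  have h := hA.toWeakBialgebra
  let b := Module.finBasis K A
  calc average Δ S g y
      = ∑ i, contract (Δ (b i)) (fun p u => b.coord i (S (piL K A Δ ε u) * g y) • p) := by
        refine Finset.sum_congr rfl fun i _ => contract_congr _ fun p u => ?_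
        rw [← hA.contract_mul_antipode, map_contract _ (f := fun z => b.coord i (S z * g y))
          (by fun_prop)]
        simp only [hg, hA.antipode_mul, mul_assoc, b]
    _ = ∑ i, contract (Δ 1) (fun p u => b.coord i (S u * g y) • (p * b i)) := by
        refine Finset.sum_congr rfl fun i _ => ?_
        rw [h.contract_piL_right (b i) (T := fun p u => b.coord i (S u * g y) • p)]
        all_goals fun_prop
    _ = contract (Δ 1) (fun p u => p * S u * g y) := by
        rw [← contract_sum]
        refine contract_congr _ fun p u => ?_
        conv_rhs => rw [mul_assoc, ← b.sum_repr (S u * g y), Finset.mul_sum]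
        simp
    _ = g y := by
        rw [← map_contract _ (f := fun z => z * g y) (by fun_prop), hA.contract_mul_antipode,
          hA.piL_one, one_mul]

theorem baer (hA : WeakHopfAlgebra K A Δ ε S) : Module.Baer A A := by
  intro I f
  obtain ⟨g, hg⟩ := LinearMap.exists_extend (p := I.restrictScalars K) (f.restrictScalars K)
  have hgI (x : A) (hx : x ∈ I) : g x = f ⟨x, hx⟩ := LinearMap.congr_fun hg ⟨x, hx⟩
  have hlin := isLinearMap_average Δ S g
  refine ⟨{ toFun := average Δ S g
            map_add' := hlin.map_add
            map_smul' := hA.map_mul_of_map_antipode_mul hlin (hA.average_antipode_mul g) },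
    fun x hx => ?_⟩
  refine (hA.average_eq g x fun a => ?_).trans (hgI x hx)
  rw [hgI _ (I.mul_mem_left _ hx), hgI x hx]
  exact f.map_smul (S a) ⟨x, hx⟩

end WeakHopfAlgebra

/-- Every weak Hopf algebra `A` over a field `K` is a quasi-Frobenius
algebra; in particular `A` is injective as a left module over itself. -/
theorem weakHopfAlgebra_selfInjective
    (K : Type*) [Field K] (A : Type*) [Ring A] [Algebra K A] [FiniteDimensional K A]
    (Δ : A →ₗ[K] A ⊗[K] A) (ε : A →ₗ[K] K) (S : A →ₗ[K] A)
    (hA : WeakHopfAlgebra K A Δ ε S) :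
    Module.Injective A A := by
  exact hA.baer.injective
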